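/- arXiv:1412.8259 — 2 statements merged into one kernel-verified Lean document; each statement's English description precedes it below -/
import Mathlib

section
/- For every integer m ≥ 0 and every real number x, B_m(1−x) = ∑_{n=0}^m s₂(m,n) · D̂_n(x), where B_m(1−x) is the m-th Bernoulli polynomial evaluated at 1−x. -/
/-- The Daehee numbers of the second kind: `D̂_0 = 1` and
`D̂_n = (-1)^(n-1) * n! / (n(n+1))` for `n ≥ 1`. -/
noncomputable def daehee2 (n : ℕ) : ℝ :=
  if n = 0 then 1 else (-1) ^ (n - 1) * (n.factorial : ℝ) / (n * (n + 1))

/-- The falling factorial `x(x-1)⋯(x-m+1)` of a real number `x` (empty product is 1). -/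
noncomputable def fallFac (x : ℝ) (m : ℕ) : ℝ := ∏ i ∈ Finset.range m, (x - i)

/-- The Daehee polynomials of the second kind
`D̂_n(x) = ∑_{m=0}^n C(n,m) D̂_{n-m} (-x)(-x-1)⋯(-x-m+1)`. -/
noncomputable def daeheePoly2 (n : ℕ) (x : ℝ) : ℝ :=
  ∑ m ∈ Finset.range (n + 1), (n.choose m : ℝ) * daehee2 (n - m) * fallFac (-x) m

/-- The Stirling numbers of the second kind, defined by the recurrence
`s₂(m+1, n+1) = (n+1) s₂(m, n+1) + s₂(m, n)`; equivalently
`x^m = ∑_{n=0}^m s₂(m,n) x(x-1)⋯(x-n+1)`. -/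
noncomputable def s2 : ℕ → ℕ → ℝ
  | 0, 0 => 1
  | 0, _ + 1 => 0
  | _ + 1, 0 => 0
  | m + 1, n + 1 => (n + 1 : ℝ) * s2 m (n + 1) + s2 m n

/-- The Bernoulli polynomial `B_n(x)` (with `B_1(0) = -1/2`), evaluated at a real `x`. -/
noncomputable def bernoulliPoly (n : ℕ) (x : ℝ) : ℝ := Polynomial.aeval x (Polynomial.bernoulli n)

noncomputable def S2T (a : ℕ → ℝ) (m : ℕ) : ℝ := ∑ n ∈ Finset.range (m + 1), s2 m n * a n

theorem s2_lt : ∀ (m n : ℕ), m < n → s2 m n = 0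
  | 0, 0, h => by omega
  | 0, n + 1, _ => by simp [s2]
  | m + 1, 0, h => by omega
  | m + 1, n + 1, h => by
    rw [s2, s2_lt m (n + 1) (by omega), s2_lt m n (by omega)]; simp

theorem S2T_E (a : ℕ → ℝ) (m : ℕ) :
    S2T (fun n => a (n + 1) + n * a n) m = S2T a (m + 1) := by
  unfold S2T
  rw [Finset.sum_range_succ' _ (m + 1)]
  have h0 : s2 (m + 1) 0 = 0 := by simp [s2]
  have h1 : ∑ n ∈ Finset.range (m + 1), (n + 1 : ℝ) * s2 m (n + 1) * a (n + 1)
      = ∑ n ∈ Finset.range (m + 1), (n : ℝ) * s2 m n * a n := by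
    have e1 := Finset.sum_range_succ' (fun n : ℕ => (n : ℝ) * s2 m n * a n) (m + 1)
    have e2 := Finset.sum_range_succ (fun n : ℕ => (n : ℝ) * s2 m n * a n) (m + 1)
    rw [s2_lt m (m + 1) (by omega)] at e2
    push_cast at e1 e2
    linarith
  rw [h0, zero_mul, add_zero]
  have h2 : ∀ n ∈ Finset.range (m + 1), s2 (m + 1) (n + 1) * a (n + 1)
      = (n + 1 : ℝ) * s2 m (n + 1) * a (n + 1) + s2 m n * a (n + 1) := by
    intro n _
    rw [s2]; ring
  rw [Finset.sum_congr rfl h2, Finset.sum_add_distrib, h1, ← Finset.sum_add_distrib]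
  exact Finset.sum_congr rfl fun n _ => by ring

theorem S2T_add (a b : ℕ → ℝ) (m : ℕ) : S2T (fun n => a n + b n) m = S2T a m + S2T b m := by
  simp [S2T, mul_add, Finset.sum_add_distrib]

theorem S2T_smul (c : ℝ) (a : ℕ → ℝ) (m : ℕ) : S2T (fun n => c * a n) m = c * S2T a m := by
  simp only [S2T, Finset.mul_sum]
  exact Finset.sum_congr rfl fun n _ => by ring

theorem choose_sum (b : ℕ → ℝ) (m : ℕ) :
    ∑ k ∈ Finset.range (m + 1 + 1), ((m + 1).choose k : ℝ) * b k
      = ∑ k ∈ Finset.range (m + 1), (m.choose k : ℝ) * b k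
        + ∑ k ∈ Finset.range (m + 1), (m.choose k : ℝ) * b (k + 1) := by
  rw [Finset.sum_range_succ']
  have e1 := Finset.sum_range_succ' (fun k : ℕ => (m.choose k : ℝ) * b k) (m + 1)
  have e2 := Finset.sum_range_succ (fun k : ℕ => (m.choose k : ℝ) * b k) (m + 1)
  simp only [Nat.choose_succ_self, Nat.cast_zero, zero_mul, add_zero] at e2
  rw [e2] at e1
  rw [e1]
  simp only [Nat.choose_succ_succ, Nat.cast_add, add_mul, Finset.sum_add_distrib,
    Nat.choose_zero_right]
  simp
  ring

theorem S2T_X (m : ℕ) : ∀ a : ℕ → ℝ, S2T (fun n => n * a (n - 1)) m + S2T a m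
      = ∑ k ∈ Finset.range (m + 1), (m.choose k : ℝ) * S2T a k := by
  induction m with
  | zero => intro a; simp [S2T]
  | succ m ih =>
    intro a
    rw [choose_sum, ← ih a]
    simp only [← S2T_E a]
    rw [← S2T_E (fun n => n * a (n - 1)), ]
    have e := ih (fun n => a (n + 1) + n * a n)
    rw [← e, ← S2T_add, ← S2T_add, ← S2T_add, ← S2T_add]
    congr 1
    funext n
    rcases n with _ | n
    · simp
    · simp only [Nat.add_sub_cancel]; push_cast; ring

theorem fallFac_succ (y : ℝ) (n : ℕ) : fallFac y (n + 1) = fallFac y n * (y - n) := by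
  simp [fallFac, Finset.prod_range_succ]

theorem S2T_fallFac (y : ℝ) (m : ℕ) : S2T (fallFac y) m = y ^ m := by
  induction m with
  | zero => simp [S2T, s2, fallFac]
  | succ m ih =>
    rw [← S2T_E, pow_succ', ← ih, ← S2T_smul]
    congr 1
    funext n
    rw [fallFac_succ]; ring

theorem fallFac_shift (y : ℝ) (n : ℕ) :
    fallFac (1 + y) (n + 1) = fallFac y (n + 1) + (n + 1) * fallFac y n := by
  induction n with
  | zero => simp [fallFac]; ring
  | succ n ih =>
    rw [fallFac_succ (1 + y), ih, fallFac_succ y (n + 1), fallFac_succ y n]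
    push_cast; ring

open PowerSeries in
theorem daehee_rec (x : ℝ) (n : ℕ) :
    (n + 2 : ℝ) * daeheePoly2 (n + 1) x + (n + 1) * ((n + 1) * daeheePoly2 n x)
      = (1 - x) * ((n + 1) * daeheePoly2 n x) + fallFac (1 - x) (n + 1) := by
  set A : PowerSeries ℝ := PowerSeries.mk fun n => daehee2 n / n.factorial with hA
  set f : PowerSeries ℝ := PowerSeries.mk fun n => fallFac (-x) n / n.factorial with hf
  have hF : ∀ n, coeff n (A * f) = daeheePoly2 n x / n.factorial := by
    intro n
    rw [mul_comm, coeff_mul, Finset.Nat.sum_antidiagonal_eq_sum_range_succ_mk, daeheePoly2,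
      Finset.sum_div]
    refine Finset.sum_congr rfl fun k hk => ?_
    have hk' : k ≤ n := by simpa [Nat.lt_succ_iff] using hk
    simp only [hA, hf, coeff_mk]
    rw [Nat.cast_choose ℝ hk']
    have := Nat.factorial_ne_zero n
    have := Nat.factorial_ne_zero k
    have := Nat.factorial_ne_zero (n - k)
    field_simp
  have h1 : (1 + X) * d⁄dX ℝ f = C (-x) * f := by
    ext n
    rw [add_mul, one_mul, map_add, coeff_C_mul]
    rcases n with _ | n
    · simp [hf, coeff_derivative, fallFac]
    · rw [coeff_succ_X_mul]
      simp only [hf, coeff_derivative, coeff_mk, fallFac_succ _ (n+1), Nat.factorial_succ (n+1)]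
      have := Nat.factorial_ne_zero (n + 1)
      push_cast
      field_simp
      ring
  have h2 : (1 + X) * d⁄dX ℝ (X * A) = X * A + (1 + X) := by
    ext n
    rw [add_mul, one_mul, map_add, map_add, map_add]
    rcases n with _ | n
    · simp [hA, coeff_derivative, daehee2, coeff_succ_X_mul, -Derivation.leibniz]
    · rw [coeff_succ_X_mul]
      simp only [coeff_derivative, coeff_succ_X_mul]
      rcases n with _ | n
      · simp [hA, daehee2, coeff_one, coeff_X]
      · have := Nat.factorial_ne_zero n
        simp [hA, daehee2, coeff_one, coeff_X, coeff_mk, Nat.factorial_succ, pow_succ]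
        field_simp
        ring
  have h3 : (1 + X) * d⁄dX ℝ (X * (A * f)) = C (1 - x) * (X * (A * f)) + (1 + X) * f := by
    have : d⁄dX ℝ (X * (A * f)) = (X * A) * d⁄dX ℝ f + f * d⁄dX ℝ (X * A) := by
      rw [← mul_assoc, Derivation.leibniz]; rfl
    rw [this, map_sub, map_one]
    rw [map_neg] at h1
    linear_combination (X * A) * h1 + f * h2
  have h4 := congrArg (coeff (n + 1)) h3
  rw [add_mul, one_mul, add_mul, one_mul, map_add, map_add, map_add, coeff_succ_X_mul,
    coeff_C_mul, coeff_succ_X_mul, coeff_succ_X_mul] at h4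
  simp only [coeff_derivative, coeff_succ_X_mul, hF] at h4
  simp only [hf, coeff_mk] at h4
  have hs := fallFac_shift (-x) n
  rw [← sub_eq_add_neg] at hs
  rw [hs]
  have := Nat.factorial_ne_zero n
  rw [Nat.factorial_succ] at h4
  push_cast at h4
  field_simp at h4
  linear_combination h4

theorem S2T_g (x : ℝ) (m : ℕ) :
    S2T (fun n => n * daeheePoly2 (n - 1) x) m = m * (1 - x) ^ (m - 1) := by
  induction m with
  | zero => simp [S2T]
  | succ m ih =>
    have : (fun n : ℕ => ((n + 1 : ℕ) : ℝ) * daeheePoly2 (n + 1 - 1) x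
        + n * (n * daeheePoly2 (n - 1) x))
        = fun n : ℕ => (1 - x) * (n * daeheePoly2 (n - 1) x) + fallFac (1 - x) n := by
      funext n
      rcases n with _ | n
      · simp [daeheePoly2, fallFac, daehee2]
      · have := daehee_rec x n
        simp only [Nat.add_sub_cancel]
        push_cast
        linear_combination this
    rw [← S2T_E (fun n => n * daeheePoly2 (n - 1) x), this, S2T_add,
      S2T_smul (1 - x) (fun n => n * daeheePoly2 (n - 1) x), ih, S2T_fallFac]
    rcases m with _ | m
    · simp
    · simp only [Nat.add_sub_cancel]; push_cast; ring

theorem S2T_sum (x : ℝ) (m : ℕ) :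
    ∑ k ∈ Finset.range (m + 1), ((m + 1).choose k : ℝ) * S2T (fun n => daeheePoly2 n x) k
      = (m + 1) * (1 - x) ^ m := by
  have h := S2T_X (m + 1) (fun n => daeheePoly2 n x)
  have h2 := S2T_g x (m + 1)
  simp only [Nat.add_sub_cancel] at h2
  rw [h2, Finset.sum_range_succ, Nat.choose_self] at h
  push_cast at h
  linarith

theorem bern_sum (y : ℝ) (m : ℕ) :
    ∑ k ∈ Finset.range (m + 1), ((m + 1).choose k : ℝ) * bernoulliPoly k y
      = (m + 1) * y ^ m := by
  have h := congrArg (Polynomial.aeval y) (Polynomial.sum_bernoulli m)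
  rw [map_sum, Polynomial.aeval_monomial] at h
  simp only [map_smul, Rat.smul_def] at h
  simpa [bernoulliPoly] using h

theorem bernoulliPoly_one_sub_eq_sum_stirling2_daeheePoly2 (m : ℕ) (x : ℝ) :
    bernoulliPoly m (1 - x) = ∑ n ∈ Finset.range (m + 1), s2 m n * daeheePoly2 n x := by
  change bernoulliPoly m (1 - x) = S2T (fun n => daeheePoly2 n x) m
  induction m using Nat.strong_induction_on with
  | _ m ih =>
    have h1 := S2T_sum x m
    rw [← bern_sum (1 - x) m, Finset.sum_range_succ, Finset.sum_range_succ] at h1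
    rw [Finset.sum_congr rfl fun k hk => by rw [← ih k (Finset.mem_range.1 hk)]] at h1
    have h2 : ((m + 1).choose m : ℝ) ≠ 0 := by simp; positivity
    exact (mul_left_cancel₀ h2 (add_left_cancel h1)).symm
end

section
/- Let λ be a positive integer. For every integer m ≥ 0, the λ-Daehee numbers satisfy D_{m,λ} = m! · ∑_{n=0}^m ∑_{(i_1,…,i_n)} (D_n/n!) · C(λ,i_1)·C(λ,i_2)⋯C(λ,i_n), where the inner sum ranges over all n-tuples of positive integers (i_1,…,i_n) with i_1 + i_2 + ⋯ + i_n = m (for n = 0 the inner sum is nonempty only when m = 0, in which case the empty product equals 1). Here D_{m,λ} = D_{m,λ}(0) = ∑_{l=0}^m s₁(m,l) · λ^l · B_l. -/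
/-- The Daehee numbers `D_n = (-1)^n * n! / (n+1)`. -/
noncomputable def daehee (n : ℕ) : ℝ := (-1) ^ n * (n.factorial : ℝ) / (n + 1)

/-- The signed Stirling numbers of the first kind, given as the coefficients of the
falling-factorial polynomial `X(X-1)⋯(X-n+1) = ∑_{l=0}^n s₁(n,l) X^l`. -/
noncomputable def s1 (n l : ℕ) : ℝ := (descPochhammer ℝ n).coeff l

open Polynomial in
/-- Umbral functional sending `X^l` to the `l`-th Bernoulli number. -/
noncomputable def umbL : ℝ[X] →ₗ[ℝ] ℝ :=
  Polynomial.lsum fun l => ((_root_.bernoulli l : ℚ) : ℝ) • LinearMap.id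

open Polynomial in
lemma umbL_monomial (l : ℕ) (a : ℝ) : umbL (monomial l a) = a * ((_root_.bernoulli l : ℚ) : ℝ) := by
  simp [umbL, Polynomial.lsum_apply, Polynomial.sum_monomial_index, mul_comm]

open Polynomial in
lemma umbL_X_pow (l : ℕ) : umbL (X ^ l) = ((_root_.bernoulli l : ℚ) : ℝ) := by
  rw [← monomial_one_right_eq_X_pow, umbL_monomial, one_mul]

open Polynomial in
lemma umbL_shift (p : ℝ[X]) : umbL (p.comp (X + 1)) - umbL p = p.coeff 1 := by
  induction p using Polynomial.induction_on' with
  | add p q hp hq => simp only [add_comp, map_add, coeff_add, ← hp, ← hq]; ring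
  | monomial n a =>
    have h := congrArg (fun x : ℚ => (x : ℝ)) (sum_bernoulli n)
    push_cast at h
    rw [← C_mul_X_pow_eq_monomial, mul_comp, C_comp, X_pow_comp, ← smul_eq_C_mul, ← smul_eq_C_mul,
      map_smul, map_smul, coeff_smul, coeff_X_pow, add_pow, map_sum, Finset.sum_range_succ]
    have h2 : ∀ k, umbL (X ^ k * 1 ^ (n - k) * (n.choose k : ℝ[X])) =
        (n.choose k : ℝ) * ((_root_.bernoulli k : ℚ) : ℝ) := by
      intro k
      rw [one_pow, mul_one, mul_comm, ← nsmul_eq_mul, map_nsmul, umbL_X_pow, nsmul_eq_mul]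
    have h5 : umbL ((X : ℝ[X]) ^ n) = ((_root_.bernoulli n : ℚ) : ℝ) := umbL_X_pow n
    rw [Finset.sum_congr rfl fun k _ => h2 k, h, h2, h5]
    simp only [smul_eq_mul, Nat.choose_self, Nat.cast_one, one_mul, @eq_comm _ 1 n]
    split_ifs <;> push_cast <;> ring

open Polynomial in
lemma umbL_desc (n : ℕ) : umbL (descPochhammer ℝ n) = daehee n := by
  have h := umbL_shift (descPochhammer ℝ (n + 1))
  have h1 : (descPochhammer ℝ (n + 1)).comp (X + 1) =
      descPochhammer ℝ (n + 1) + ((n : ℝ) + 1) • descPochhammer ℝ n := by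
    have h3 := congrArg (fun p : ℝ[X] => p.comp (X + 1)) (descPochhammer_succ_comp_X_sub_one ℝ n)
    simp only [comp_assoc, sub_comp, X_comp, one_comp, add_sub_cancel_right, comp_X, smul_eq_mul,
      mul_comp, add_comp, natCast_comp] at h3
    rw [smul_eq_C_mul, C_add, C_1, ← C_eq_natCast] at *
    linear_combination -h3
  have h4 : (descPochhammer ℝ (n + 1)).coeff 1 = (-1) ^ n * (n.factorial : ℝ) := by
    rw [descPochhammer_succ_left, coeff_X_mul, coeff_zero_eq_eval_zero, eval_comp]
    simp only [eval_sub, eval_X, eval_one, zero_sub]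
    clear h h1
    induction n with
    | zero => simp
    | succ n ih =>
      rw [descPochhammer_succ_eval, ih, Nat.factorial_succ]; push_cast; ring
  rw [h1, map_add, map_smul, h4, add_sub_cancel_left, smul_eq_mul] at h
  have : (n : ℝ) + 1 ≠ 0 := by positivity
  rw [daehee, eq_div_iff this, ← h, mul_comm]

open Polynomial in
lemma compos_coeff (lam n m : ℕ) :
    ∑ i ∈ (Finset.Nat.antidiagonalTuple n m).filter (fun i => ∀ j, 0 < i j),
      ∏ j, (lam.choose (i j) : ℝ) = (((1 + X : ℝ[X]) ^ lam - 1) ^ n).coeff m := by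
  have hc : ∀ k, ((1 + X : ℝ[X]) ^ lam - 1).coeff k = if 0 < k then (lam.choose k : ℝ) else 0 := by
    intro k
    rw [coeff_sub, coeff_one_add_X_pow, coeff_one]
    rcases Nat.eq_zero_or_pos k with rfl | hk
    · simp
    · simp [hk, hk.ne']
  rw [← Polynomial.coeff_coe, Polynomial.coe_pow,
    show ((((1 + X : ℝ[X]) ^ lam - 1 : ℝ[X]) : PowerSeries ℝ)) ^ n =
      ∏ _j : Fin n, (((1 + X : ℝ[X]) ^ lam - 1 : ℝ[X]) : PowerSeries ℝ) by simp,
    PowerSeries.coeff_prod, Finset.sum_filter]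
  symm
  refine Finset.sum_bij (fun (l : Fin n →₀ ℕ) _ => (l : Fin n → ℕ)) ?_ ?_ ?_ ?_
  · intro l hl
    rw [Finset.Nat.mem_antidiagonalTuple]
    exact (Finset.mem_finsuppAntidiag.1 hl).1
  · intro l _ l' _ h
    exact DFunLike.coe_injective h
  · intro i hi
    rw [Finset.Nat.mem_antidiagonalTuple] at hi
    refine ⟨Finsupp.equivFunOnFinite.symm i, ?_, by simp⟩
    rw [Finset.mem_finsuppAntidiag]
    exact ⟨by simpa using hi, Finset.subset_univ _⟩
  intro i _
  symm
  simp only [Polynomial.coeff_coe, hc]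
  split_ifs with h
  · exact Finset.prod_congr rfl fun j _ => by simp [show 0 < i j from h j]
  · push Not at h
    obtain ⟨j, hj⟩ := h
    refine (Finset.prod_eq_zero (Finset.mem_univ j) ?_).symm
    simp [Nat.le_zero.1 hj]

open Polynomial in
lemma coeff_zero_of_lt (lam n m : ℕ) (h : m < n) :
    (((1 + X : ℝ[X]) ^ lam - 1) ^ n).coeff m = 0 := by
  have hd : (X : ℝ[X]) ∣ (1 + X : ℝ[X]) ^ lam - 1 := by
    have h0 := sub_dvd_pow_sub_pow (1 + X : ℝ[X]) 1 lam
    rwa [one_pow, show (1 + X : ℝ[X]) - 1 = X by ring] at h0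
  exact X_pow_dvd_iff.1 (pow_dvd_pow_of_dvd hd n) m h

open Polynomial in
lemma choose_mul_eq (lam k m : ℕ) : ((lam * k).choose m : ℝ) =
    ∑ n ∈ Finset.range (m + 1), (k.choose n : ℝ) * (((1 + X : ℝ[X]) ^ lam - 1) ^ n).coeff m := by
  have h : ((1 + X : ℝ[X]) ^ (lam * k)) = ((((1 + X : ℝ[X]) ^ lam - 1)) + 1) ^ k := by
    rw [sub_add_cancel, pow_mul]
  rw [← coeff_one_add_X_pow, h, add_pow, finsetSum_coeff]
  have e1 := Finset.sum_subset (f := fun n => (k.choose n : ℝ) *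
      (((1 + X : ℝ[X]) ^ lam - 1) ^ n).coeff m)
    (Finset.range_subset_range.2 (show k + 1 ≤ k + m + 1 by omega)) (by
      intro n _ hn
      rw [Finset.mem_range, not_lt] at hn
      simp [Nat.choose_eq_zero_of_lt (show k < n by omega)])
  have e2 := Finset.sum_subset (f := fun n => (k.choose n : ℝ) *
      (((1 + X : ℝ[X]) ^ lam - 1) ^ n).coeff m)
    (Finset.range_subset_range.2 (show m + 1 ≤ k + m + 1 by omega)) (by
      intro n _ hn
      rw [Finset.mem_range, not_lt] at hn
      simp only [coeff_zero_of_lt lam n m (show m < n by omega), mul_zero])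
  rw [e2, ← e1]
  refine Finset.sum_congr rfl fun n _ => ?_
  rw [one_pow, mul_one, coeff_mul_natCast, mul_comm]

open Polynomial in
lemma desc_comp (lam m : ℕ) : (descPochhammer ℝ m).comp (C (lam : ℝ) * X) =
    ∑ n ∈ Finset.range (m + 1), ((m.factorial : ℝ) * ((((1 + X : ℝ[X]) ^ lam - 1) ^ n).coeff m /
      (n.factorial : ℝ))) • descPochhammer ℝ n := by
  apply Polynomial.eq_of_infinite_eval_eq
  refine (Set.infinite_range_of_injective (Nat.cast_injective (R := ℝ))).mono ?_
  rintro _ ⟨k, rfl⟩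
  simp only [Set.mem_ofPred_eq, eval_comp, eval_mul, eval_C, eval_X, eval_finsetSum, eval_smul,
    smul_eq_mul]
  rw [← Nat.cast_mul, descPochhammer_eval_eq_descFactorial, Nat.descFactorial_eq_factorial_mul_choose,
    Nat.cast_mul, choose_mul_eq, Finset.mul_sum]
  refine Finset.sum_congr rfl fun n _ => ?_
  rw [descPochhammer_eval_eq_descFactorial, Nat.descFactorial_eq_factorial_mul_choose, Nat.cast_mul]
  have : (n.factorial : ℝ) ≠ 0 := by positivity
  field_simp


/-- `D_{m,λ} = m! ∑_{n=0}^m ∑_{i₁+⋯+iₙ=m, iⱼ ≥ 1} (D_n/n!) C(λ,i₁)⋯C(λ,iₙ)`,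
where `D_{m,λ} = ∑_{l=0}^m s₁(m,l) λ^l B_l`. -/
theorem lambdaDaehee_eq_sum_over_compositions (lam : ℕ) (hlam : 0 < lam) (m : ℕ) :
    (∑ l ∈ Finset.range (m + 1), s1 m l * (lam : ℝ) ^ l * (bernoulli l : ℝ)) =
      (m.factorial : ℝ) *
        ∑ n ∈ Finset.range (m + 1),
          ∑ i ∈ (Finset.Nat.antidiagonalTuple n m).filter (fun i => ∀ j, 0 < i j),
            (daehee n / (n.factorial : ℝ)) * ∏ j, (lam.choose (i j) : ℝ) := by
  have h := congrArg umbL (desc_comp lam m)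
  rw [map_sum] at h
  have hl : umbL ((descPochhammer ℝ m).comp (Polynomial.C (lam : ℝ) * Polynomial.X)) =
      ∑ l ∈ Finset.range (m + 1), s1 m l * (lam : ℝ) ^ l * (bernoulli l : ℝ) := by
    rw [Polynomial.comp, Polynomial.eval₂_eq_sum_range, descPochhammer_natDegree, map_sum]
    refine Finset.sum_congr rfl fun l _ => ?_
    rw [mul_pow, ← Polynomial.C_pow, ← mul_assoc, ← Polynomial.C_mul,
      Polynomial.C_mul_X_pow_eq_monomial, umbL_monomial, s1]
  rw [← hl, h, Finset.mul_sum]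
  refine Finset.sum_congr rfl fun n _ => ?_
  rw [← Finset.mul_sum, compos_coeff, map_smul, umbL_desc, smul_eq_mul]
  ring
end
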